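/- arXiv:1804.03044 — 2 statements merged into one kernel-verified Lean document; each statement's English description precedes it below -/
import Mathlib

section
/- For r ∈ (0,1) and ϑ ∈ [0,π]: Σ_{l=2}^∞ (2l+1) l(l-1) r^l P_l(cos ϑ) = -r² [5 - 23r² + 2r⁴ + 4r(7+r²)cos ϑ - (15+r²)cos²ϑ] / (1 - 2r cos ϑ + r²)^{7/2}. -/
open Real MeasureTheory

/-- The Legendre polynomial `P_l(t) = (1/(2^l l!)) dˡ/dtˡ (t²-1)ˡ`. -/
noncomputable def legendreP (l : ℕ) (t : ℝ) : ℝ :=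
  (1 / (2 ^ l * (l.factorial : ℝ))) * iteratedDeriv l (fun s : ℝ => (s ^ 2 - 1) ^ l) t


section Rodrigues

open Polynomial

theorem iteratedDeriv_polynomial_eval (p : ℝ[X]) (n : ℕ) :
    iteratedDeriv n (fun t => p.eval t) = fun t => (derivative^[n] p).eval t := by
  induction n with
  | zero => simp
  | succ n ih =>
    rw [iteratedDeriv_succ, ih, Function.iterate_succ_apply']
    ext t
    exact Polynomial.deriv _

theorem iterate_derivative_succ_X_mul (p : ℝ[X]) (n : ℕ) :
    derivative^[n + 1] (X * p)
      = X * derivative^[n + 1] p + (n + 1 : ℝ[X]) * derivative^[n] p := by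
  induction n with
  | zero => simp [add_comm]
  | succ n ih =>
    rw [Function.iterate_succ_apply', ih, Function.iterate_succ_apply' _ (n + 1) p,
      Function.iterate_succ_apply' _ n p]
    simp only [derivative_add, derivative_mul, derivative_X, derivative_one, derivative_natCast]
    push_cast
    ring

theorem derivative_X_sq_sub_one_pow (n : ℕ) :
    derivative ((X ^ 2 - 1 : ℝ[X]) ^ (n + 1))
      = C (2 * (n + 1) : ℝ) * (X * (X ^ 2 - 1) ^ n) := by
  rw [derivative_pow_succ]
  simp only [derivative_sub, derivative_X_sq, derivative_one, map_mul, map_add, map_natCast,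
    map_one, map_ofNat]
  ring

/-- The unnormalised Legendre polynomial `dˡ/dXˡ (X²-1)ˡ`. -/
noncomputable def rodriguesPoly (l : ℕ) : ℝ[X] := derivative^[l] ((X ^ 2 - 1) ^ l)

theorem legendreP_eq (l : ℕ) (t : ℝ) :
    legendreP l t = (rodriguesPoly l).eval t / (2 ^ l * (l.factorial : ℝ)) := by
  have h : (fun s : ℝ => (s ^ 2 - 1) ^ l) = fun s => ((X ^ 2 - 1 : ℝ[X]) ^ l).eval s := by
    ext s; simp
  rw [legendreP, h, iteratedDeriv_polynomial_eval, rodriguesPoly]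
  ring

theorem rodriguesPoly_recurrence (n : ℕ) :
    rodriguesPoly (n + 2)
      = C (2 * (2 * n + 3) : ℝ) * (X * rodriguesPoly (n + 1))
        - C (4 * (n + 1) ^ 2 : ℝ) * rodriguesPoly n := by
  have hfirst : derivative ((X ^ 2 - 1 : ℝ[X]) ^ (n + 2))
      = C (2 * (n + 2) : ℝ) * (X * (X ^ 2 - 1) ^ (n + 1)) := by
    rw [derivative_X_sq_sub_one_pow (n + 1)]
    congr 2
    push_cast
    ring
  have hsecond : derivative (derivative ((X ^ 2 - 1 : ℝ[X]) ^ (n + 2)))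
      = C (2 * (n + 2) * (2 * n + 3) : ℝ) * (X ^ 2 - 1) ^ (n + 1)
        + C (4 * (n + 1) * (n + 2) : ℝ) * (X ^ 2 - 1) ^ n := by
    rw [hfirst, derivative_C_mul, derivative_mul, derivative_X_sq_sub_one_pow, derivative_X]
    simp only [map_mul, map_add, map_one, map_ofNat, map_natCast]
    ring
  have ha : rodriguesPoly (n + 2)
      = C (2 * (n + 2) * (2 * n + 3) : ℝ) * derivative^[n] ((X ^ 2 - 1) ^ (n + 1))
        + C (4 * (n + 1) * (n + 2) : ℝ) * rodriguesPoly n := by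
    rw [rodriguesPoly, Function.iterate_succ_apply, Function.iterate_succ_apply, hsecond,
      iterate_map_add, iterate_derivative_C_mul, iterate_derivative_C_mul, rodriguesPoly]
  have hb : rodriguesPoly (n + 2)
      = C (2 * (n + 2) : ℝ) * (X * rodriguesPoly (n + 1)
        + (n + 1 : ℝ[X]) * derivative^[n] ((X ^ 2 - 1) ^ (n + 1))) := by
    rw [rodriguesPoly, Function.iterate_succ_apply, hfirst, iterate_derivative_C_mul,
      iterate_derivative_succ_X_mul, rodriguesPoly]
  have hn : (n + 2 : ℝ[X]) ≠ 0 := by exact_mod_cast (by omega : n + 2 ≠ 0)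
  simp only [map_mul, map_add, map_pow, map_one, map_ofNat, map_natCast] at *
  have key : ((n : ℝ[X]) + 2) * rodriguesPoly (n + 2)
      = ((n : ℝ[X]) + 2) * (2 * (2 * (n : ℝ[X]) + 3) * (X * rodriguesPoly (n + 1))
        - 4 * ((n : ℝ[X]) + 1) ^ 2 * rodriguesPoly n) := by
    linear_combination (2 * (n : ℝ[X]) + 3) * hb - ((n : ℝ[X]) + 1) * ha
  exact mul_left_cancel₀ hn key

theorem legendreP_zero (t : ℝ) : legendreP 0 t = 1 := by simp [legendreP]

theorem legendreP_one (t : ℝ) : legendreP 1 t = t := by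
  simp [legendreP_eq, rodriguesPoly, one_add_one_eq_two]

/-- Bonnet's recursion formula. -/
theorem legendreP_recurrence (n : ℕ) (t : ℝ) :
    (n + 2) * legendreP (n + 2) t
      = (2 * n + 3) * t * legendreP (n + 1) t - (n + 1) * legendreP n t := by
  have hfac : (n.factorial : ℝ) ≠ 0 := by exact_mod_cast n.factorial_ne_zero
  have h1 : (n + 1 : ℝ) ≠ 0 := by positivity
  have h2 : (n + 2 : ℝ) ≠ 0 := by positivity
  have h12 : (n + 1 + 1 : ℝ) ≠ 0 := by positivity
  simp only [legendreP_eq, rodriguesPoly_recurrence, eval_sub, eval_mul, eval_C, eval_X,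
    Nat.factorial_succ]
  push_cast
  field_simp
  ring

end Rodrigues

theorem legendreP_energy_le (t : ℝ) (n : ℕ) :
    (1 - t ^ 2) * legendreP (n + 1) t ^ 2 + (legendreP n t - t * legendreP (n + 1) t) ^ 2
      ≤ 1 - t ^ 2 := by
  induction n with
  | zero =>
    rw [legendreP_zero, legendreP_one]
    nlinarith
  | succ n ih =>
    have hn : (0 : ℝ) < n + 2 := by positivity
    set c : ℝ := (n + 1) / (n + 2) with hc
    have hc0 : 0 ≤ c := by positivity
    have hc1 : c ≤ 1 := by rw [hc, div_le_one hn]; linarith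
    have hrec : legendreP (n + 2) t = t * legendreP (n + 1) t
        - c * (legendreP n t - t * legendreP (n + 1) t) := by
      rw [hc]
      field_simp
      linear_combination legendreP_recurrence n t
    have hstep : (1 - t ^ 2) * legendreP (n + 2) t ^ 2
        + (legendreP (n + 1) t - t * legendreP (n + 2) t) ^ 2
        = (1 - t ^ 2) * legendreP (n + 1) t ^ 2
          + c ^ 2 * (legendreP n t - t * legendreP (n + 1) t) ^ 2 := by
      rw [hrec]; ring
    rw [hstep]
    nlinarith [sq_nonneg (legendreP n t - t * legendreP (n + 1) t),
      mul_le_mul_of_nonneg_right (pow_le_one₀ hc0 hc1 : c ^ 2 ≤ 1)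
        (sq_nonneg (legendreP n t - t * legendreP (n + 1) t))]

theorem abs_legendreP_le_one {t : ℝ} (ht : t ^ 2 ≤ 1) (n : ℕ) : |legendreP n t| ≤ 1 := by
  induction n with
  | zero => simp [legendreP_zero]
  | succ n ih =>
    have hE := legendreP_energy_le t n
    rcases ht.lt_or_eq with h | h
    · rw [← sq_le_one_iff_abs_le_one]
      nlinarith [sq_nonneg (legendreP n t - t * legendreP (n + 1) t)]
    · have hd : legendreP n t - t * legendreP (n + 1) t = 0 := by
        rw [← sq_eq_zero_iff]
        nlinarith [sq_nonneg (legendreP n t - t * legendreP (n + 1) t)]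
      have : legendreP (n + 1) t = t * legendreP n t := by
        linear_combination -t * hd - legendreP (n + 1) t * h
      rw [this, abs_mul]
      exact mul_le_one₀ (abs_le_one_iff_mul_self_le_one.mpr (by nlinarith)) (abs_nonneg _) ih

/-- Sequences of at most polynomial growth. -/
def PolyBounded (c : ℕ → ℝ) : Prop := ∃ (K : ℝ) (k : ℕ), ∀ n, |c n| ≤ K * (n + 1) ^ k

/-- The coefficients of the termwise derivative of the power series with coefficients `c`. -/
def derivCoeff (c : ℕ → ℝ) (n : ℕ) : ℝ := (n + 1) * c (n + 1)

theorem PolyBounded.derivCoeff {c : ℕ → ℝ} (hc : PolyBounded c) :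
    PolyBounded (derivCoeff c) := by
  obtain ⟨K, k, h⟩ := hc
  have hK : 0 ≤ K := by simpa using (abs_nonneg _).trans (h 0)
  refine ⟨K * 2 ^ k, k + 1, fun n => ?_⟩
  have hn : (0 : ℝ) ≤ n + 1 := by positivity
  rw [_root_.derivCoeff, abs_mul, abs_of_nonneg hn]
  calc (n + 1 : ℝ) * |c (n + 1)| ≤ (n + 1) * (K * (((n + 1 : ℕ) : ℝ) + 1) ^ k) := by
        gcongr; exact h (n + 1)
    _ ≤ (n + 1) * (K * (2 * (n + 1)) ^ k) := by
        gcongr; push_cast; linarith [(Nat.cast_nonneg n : (0 : ℝ) ≤ n)]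
    _ = K * 2 ^ k * (n + 1) ^ (k + 1) := by rw [mul_pow]; ring

theorem PolyBounded.summable_abs {c : ℕ → ℝ} (hc : PolyBounded c) {r : ℝ} (h0 : 0 ≤ r)
    (h1 : r < 1) : Summable fun n => |c n| * r ^ n := by
  obtain ⟨K, k, h⟩ := hc
  have hr : ‖r‖ < 1 := by rwa [Real.norm_eq_abs, abs_of_nonneg h0]
  have hs := ((summable_nat_add_iff (f := fun n : ℕ => (n : ℝ) ^ k * r ^ n) 1).mpr
    (summable_pow_mul_geometric_of_norm_lt_one k hr)).mul_left (K * 2 ^ k)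
  have hK : 0 ≤ K := by simpa using (abs_nonneg _).trans (h 0)
  rw [← summable_nat_add_iff 1]
  refine Summable.of_nonneg_of_le (fun n => by positivity) (fun n => ?_) hs
  have hn : (((n + 1 : ℕ) : ℝ) + 1) ≤ 2 * ((n + 1 : ℕ) : ℝ) := by
    push_cast
    linarith [(Nat.cast_nonneg n : (0 : ℝ) ≤ n)]
  have hle : |c (n + 1)| ≤ K * (2 * ((n + 1 : ℕ) : ℝ)) ^ k :=
    (h (n + 1)).trans (by gcongr)
  refine (mul_le_mul_of_nonneg_right hle (pow_nonneg h0 (n + 1))).trans_eq ?_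
  rw [mul_pow]
  ring

theorem PolyBounded.hasSum {c : ℕ → ℝ} (hc : PolyBounded c) {r : ℝ} (hr : |r| < 1) :
    HasSum (fun n => c n * r ^ n) (∑' n, c n * r ^ n) := by
  refine (Summable.of_norm ?_).hasSum
  simpa [abs_mul, abs_pow] using hc.summable_abs (abs_nonneg r) hr

theorem HasSum.natCast_mul_coeff {c : ℕ → ℝ} {r s : ℝ}
    (h : HasSum (fun n => derivCoeff c n * r ^ n) s) :
    HasSum (fun n : ℕ => n * c n * r ^ n) (r * s) := by
  rw [← hasSum_nat_add_iff' 1]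
  simpa [derivCoeff, pow_succ, mul_comm, mul_left_comm, mul_assoc] using h.mul_left r

theorem PolyBounded.hasDerivAt_tsum {c : ℕ → ℝ} (hc : PolyBounded c) {r : ℝ} (hr : |r| < 1) :
    HasDerivAt (fun y => ∑' n, c n * y ^ n) (∑' n, _root_.derivCoeff c n * r ^ n) r := by
  obtain ⟨ρ, hrρ, hρ1⟩ := exists_between hr
  have hρ0 : 0 < ρ := (abs_nonneg r).trans_lt hrρ
  have hu : Summable fun n : ℕ => n * |c n| * ρ ^ (n - 1) := by
    rw [← summable_nat_add_iff 1]
    refine (hc.derivCoeff.summable_abs hρ0.le hρ1).congr fun n => ?_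
    have hn : (0 : ℝ) ≤ n + 1 := by positivity
    simp [_root_.derivCoeff, abs_mul, abs_of_nonneg hn]
  have hball : ∀ y : ℝ, y ∈ Metric.ball (0 : ℝ) ρ ↔ |y| < ρ := fun y => by simp
  have hbound : ∀ (n : ℕ) (y : ℝ), y ∈ Metric.ball (0 : ℝ) ρ →
      ‖c n * (n * y ^ (n - 1))‖ ≤ n * |c n| * ρ ^ (n - 1) := fun n y hy => by
    have := ((hball y).mp hy).le
    rw [Real.norm_eq_abs, abs_mul, abs_mul, abs_pow, Nat.abs_cast, mul_left_comm, ← mul_assoc]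
    gcongr
  have hd := hasDerivAt_tsum_of_isPreconnected (g := fun n y => c n * y ^ n)
    (g' := fun n y => c n * (n * y ^ (n - 1))) hu Metric.isOpen_ball
    (convex_ball (0 : ℝ) ρ).isPreconnected (fun n y _ => (hasDerivAt_pow n y).const_mul (c n))
    hbound ((hball r).mpr hrρ) (hc.hasSum hr).summable ((hball r).mpr hrρ)
  convert! hd using 1
  rw [(Summable.of_norm_bounded hu fun n => hbound n r ((hball r).mpr hrρ)).tsum_eq_zero_add]
  simp [_root_.derivCoeff, mul_comm, mul_left_comm]

theorem polyBounded_legendreP {x : ℝ} (hx : x ^ 2 ≤ 1) : PolyBounded fun n => legendreP n x :=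
  ⟨1, 0, fun n => by simpa using abs_legendreP_le_one hx n⟩

theorem one_sub_two_mul_add_sq_pos {x r : ℝ} (hx : x ^ 2 ≤ 1) (hr : |r| < 1) :
    0 < 1 - 2 * r * x + r ^ 2 := by
  have hr2 : r ^ 2 < 1 := (sq_lt_one_iff_abs_lt_one r).mpr hr
  rcases eq_or_ne (r * x) 1 with h | h
  · nlinarith [mul_pow r x 2, sq_nonneg r, sq_nonneg x]
  · nlinarith [mul_pow r x 2, sq_nonneg r, sq_nonneg (r - x), sq_pos_of_ne_zero (sub_ne_zero.mpr h)]

theorem legendreP_genFun_ode {x r : ℝ} (hx : x ^ 2 ≤ 1) (hr : |r| < 1) :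
    (1 - 2 * r * x + r ^ 2) * ∑' n, derivCoeff (fun n => legendreP n x) n * r ^ n
      = (x - r) * ∑' n, legendreP n x * r ^ n := by
  have hP := polyBounded_legendreP hx
  have h0 := hP.hasSum hr
  have h1 := hP.derivCoeff.hasSum hr
  set f := ∑' n, legendreP n x * r ^ n
  set f' := ∑' n, derivCoeff (fun n => legendreP n x) n * r ^ n
  have h0s := (hasSum_nat_add_iff' 1).mpr h0
  have h1s := (hasSum_nat_add_iff' 1).mpr h1
  have hsum := (((h1s.sub (h1.mul_left (2 * x * r))).add
    (h1.natCast_mul_coeff.mul_left r)).sub (h0s.mul_left x)).add (h0.mul_left r)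
  have hzero := hsum.unique (by
    convert! (hasSum_zero : HasSum (fun _ : ℕ => (0 : ℝ)) 0) using 1
    ext n
    simp only [derivCoeff]
    push_cast
    linear_combination r ^ (n + 1) * legendreP_recurrence n x)
  simp [derivCoeff, legendreP_zero, legendreP_one] at hzero
  linear_combination hzero

/-- The generating function of the Legendre polynomials. -/
theorem tsum_legendreP_mul_sqrt {x r : ℝ} (hx : x ^ 2 ≤ 1) (hr : |r| < 1) :
    (∑' n, legendreP n x * r ^ n) * √(1 - 2 * r * x + r ^ 2) = 1 := by
  have hP := polyBounded_legendreP hx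
  have hball : ∀ y : ℝ, y ∈ Metric.ball (0 : ℝ) 1 ↔ |y| < 1 := fun y => by simp
  have hderiv : ∀ y : ℝ, |y| < 1 →
      HasDerivAt (fun y => (∑' n, legendreP n x * y ^ n) * √(1 - 2 * y * x + y ^ 2)) 0 y := by
    intro y hy
    have hD := one_sub_two_mul_add_sq_pos hx hy
    have hDd : HasDerivAt (fun y : ℝ => 1 - 2 * y * x + y ^ 2) (2 * (y - x)) y := by
      convert! (((((hasDerivAt_id y).const_mul 2).mul_const x).const_sub 1).add
        (hasDerivAt_pow 2 y)) using 1
      simp; ring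
    convert! (hP.hasDerivAt_tsum hy).mul (hDd.sqrt hD.ne') using 1
    have hs := Real.sq_sqrt hD.le
    have hs0 := (Real.sqrt_pos.mpr hD).ne'
    field_simp
    rw [hs]
    linear_combination -legendreP_genFun_ode hx hy
  have hconst := Metric.isOpen_ball.is_const_of_deriv_eq_zero
    (convex_ball (0 : ℝ) 1).isPreconnected
    (fun y hy => (hderiv y ((hball y).mp hy)).differentiableAt.differentiableWithinAt)
    (fun y hy => (hderiv y ((hball y).mp hy)).deriv) ((hball r).mpr hr)
    ((hball 0).mpr (by simp))
  rw [hconst, tsum_eq_single 0 (fun n hn => by simp [hn])]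
  simp [legendreP_zero]

theorem stmt_14 (r ϑ : ℝ) (hr : r ∈ Set.Ioo (0:ℝ) 1) (hϑ : ϑ ∈ Set.Icc 0 Real.pi) :
    HasSum (fun l : ℕ => (2 * l + 1) * (l : ℝ) * ((l : ℝ) - 1) * r ^ l * legendreP l (Real.cos ϑ))
      (-r ^ 2 * (5 - 23 * r ^ 2 + 2 * r ^ 4
              + 4 * r * (7 + r ^ 2) * Real.cos ϑ
              - (15 + r ^ 2) * Real.cos ϑ ^ 2)
        / (1 - 2 * r * Real.cos ϑ + r ^ 2) ^ ((7 : ℝ) / 2)) := by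
  set x := Real.cos ϑ
  have hx : x ^ 2 ≤ 1 := Real.cos_sq_le_one ϑ
  have habs : ∀ y ∈ Set.Ioo (0 : ℝ) 1, |y| < 1 := fun y hy => by rw [abs_of_pos hy.1]; exact hy.2
  have hr1 := habs r hr
  have hP := polyBounded_legendreP hx
  have hP1 := hP.derivCoeff
  have hP2 := hP1.derivCoeff
  have hP3 := hP2.derivCoeff
  have hD := one_sub_two_mul_add_sq_pos hx hr1
  have hnhds : Set.Ioo (0 : ℝ) 1 ∈ nhds r := isOpen_Ioo.mem_nhds hr
  have hDd : ∀ y : ℝ, HasDerivAt (fun y : ℝ => 1 - 2 * y * x + y ^ 2) (2 * (y - x)) y := by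
    intro y
    convert! (((((hasDerivAt_id y).const_mul 2).mul_const x).const_sub 1).add
      (hasDerivAt_pow 2 y)) using 1
    simp; ring
  have hXd : ∀ y : ℝ, HasDerivAt (fun y : ℝ => x - y) (-1) y := fun y => by
    simpa using (hasDerivAt_id y).const_sub x
  have ode1 : ∀ y ∈ Set.Ioo (0 : ℝ) 1, _ := fun y hy => legendreP_genFun_ode hx (habs y hy)
  have ode2 : ∀ y ∈ Set.Ioo (0 : ℝ) 1,
      (1 - 2 * y * x + y ^ 2) * ∑' n, derivCoeff (derivCoeff fun n => legendreP n x) n * y ^ n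
        = 3 * (x - y) * ∑' n, derivCoeff (fun n => legendreP n x) n * y ^ n
          - ∑' n, legendreP n x * y ^ n := by
    intro y hy
    have h := ((hDd y).mul (hP1.hasDerivAt_tsum (habs y hy))).unique
      (((hXd y).mul (hP.hasDerivAt_tsum (habs y hy))).congr_of_eventuallyEq
        (Filter.eventually_of_mem (isOpen_Ioo.mem_nhds hy) ode1))
    linear_combination h
  have ode3 : (1 - 2 * r * x + r ^ 2)
        * ∑' n, derivCoeff (derivCoeff (derivCoeff fun n => legendreP n x)) n * r ^ n
      = 5 * (x - r) * ∑' n, derivCoeff (derivCoeff fun n => legendreP n x) n * r ^ n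
        - 4 * ∑' n, derivCoeff (fun n => legendreP n x) n * r ^ n := by
    have h := ((hDd r).mul (hP2.hasDerivAt_tsum hr1)).unique
      (((((hXd r).const_mul 3).mul (hP1.hasDerivAt_tsum hr1)).sub
        (hP.hasDerivAt_tsum hr1)).congr_of_eventuallyEq (Filter.eventually_of_mem hnhds ode2))
    linear_combination h
  have e1 := ode1 r hr
  have e2 := ode2 r hr
  have e0 := tsum_legendreP_mul_sqrt hx hr1
  have h2 := hP2.hasSum hr1
  have h3 := (hP3.hasSum hr1).natCast_mul_coeff
  set D := 1 - 2 * r * x + r ^ 2 with hDdef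
  set f0 := ∑' n, legendreP n x * r ^ n
  set f1 := ∑' n, derivCoeff (fun n => legendreP n x) n * r ^ n
  set f2 := ∑' n, derivCoeff (derivCoeff fun n => legendreP n x) n * r ^ n
  set f3 := ∑' n, derivCoeff (derivCoeff (derivCoeff fun n => legendreP n x)) n * r ^ n
  have hpow : D ^ ((7 : ℝ) / 2) = D ^ 3 * √D := by
    rw [Real.sqrt_eq_rpow, ← Real.rpow_natCast D 3, ← Real.rpow_add hD]
    norm_num
  have hval : r ^ 2 * (2 * (r * f3) + 5 * f2)
      = -r ^ 2 * (5 - 23 * r ^ 2 + 2 * r ^ 4 + 4 * r * (7 + r ^ 2) * x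
        - (15 + r ^ 2) * x ^ 2) / D ^ ((7 : ℝ) / 2) := by
    have d1 : D * f1 = (x - r) * f0 := e1
    have d2 : D ^ 2 * f2 = (3 * (x - r) ^ 2 - D) * f0 := by
      linear_combination D * e2 + 3 * (x - r) * d1
    have d3 : D ^ 3 * f3 = (15 * (x - r) ^ 3 - 9 * (x - r) * D) * f0 := by
      linear_combination D ^ 2 * ode3 + 5 * (x - r) * d2 - 4 * D * d1
    rw [hpow, eq_div_iff (by have := Real.sqrt_pos.mpr hD; positivity)]
    have hcomb : r ^ 2 * (2 * (r * f3) + 5 * f2) * (D ^ 3 * √D)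
        = r ^ 2 * (2 * r * (15 * (x - r) ^ 3 - 9 * (x - r) * D)
          + 5 * D * (3 * (x - r) ^ 2 - D)) := by
      linear_combination 2 * r ^ 3 * √D * d3 + 5 * r ^ 2 * D * √D * d2
        + r ^ 2 * (2 * r * (15 * (x - r) ^ 3 - 9 * (x - r) * D)
          + 5 * D * (3 * (x - r) ^ 2 - D)) * e0
    rw [hcomb, hDdef]
    ring
  rw [← hval, ← hasSum_nat_add_iff' 2]
  convert! ((h3.mul_left 2).add (h2.mul_left 5)).mul_left (r ^ 2) using 1
  · ext n
    simp only [derivCoeff]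
    push_cast
    ring
  · simp [Finset.sum_range_succ]
end

section
/- Let β_l(r) denote, for l ≥ 9, the expression β_l = (l+2)(l+3)(l+4)(l+5)³ r^{l+5}/((2l+3)(2l+5)(2l+7)(2l+9)) - (l+2)(l+3)³(5l²+21l-8) r^{l+3}/((2l-1)(2l+3)(2l+5)(2l+9)) + 2(l+1)²(10l⁵+65l⁴+83l³-134l²-186l+36) r^{l+1}/((2l-3)(2l-1)(2l+3)(2l+5)(2l+7)) - 2(l-1)²(5l⁴-2l³-41l²+14l+60) r^{l-1}/((2l-5)(2l-3)(2l+3)(2l+5)) + (l-3)²(l-2)(l-1)(20l⁴-100l³+39l²+239l-48) r^{l-3}/((2l-7)(2l-5)(2l-3)(2l-1)(2l+1)(2l+3)) - (l-5)²(l-4)(l-3)(l-2)(l-1) r^{l-5}/((2l-7)(2l-5)(2l-3)(2l-1)), with r = e^{-ρ}. Then the limit as l → ∞ of ∫_0^∞ ρ · β_l(e^{-ρ})² dρ equals 1/256. -/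
open Real MeasureTheory Filter

/-- The coefficient `β_l(r)` from Lemma 3.1 (valid formula for `l ≥ 9`). -/
noncomputable def betaCoeff (l : ℕ) (r : ℝ) : ℝ :=
  ((l : ℝ) + 2) * ((l : ℝ) + 3) * ((l : ℝ) + 4) * ((l : ℝ) + 5) ^ 3 * r ^ (l + 5)
      / ((2 * (l : ℝ) + 3) * (2 * (l : ℝ) + 5) * (2 * (l : ℝ) + 7) * (2 * (l : ℝ) + 9))
    - ((l : ℝ) + 2) * ((l : ℝ) + 3) ^ 3 * (5 * (l : ℝ) ^ 2 + 21 * l - 8) * r ^ (l + 3)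
      / ((2 * (l : ℝ) - 1) * (2 * (l : ℝ) + 3) * (2 * (l : ℝ) + 5) * (2 * (l : ℝ) + 9))
    + 2 * ((l : ℝ) + 1) ^ 2
        * (10 * (l : ℝ) ^ 5 + 65 * (l : ℝ) ^ 4 + 83 * (l : ℝ) ^ 3 - 134 * (l : ℝ) ^ 2
            - 186 * l + 36) * r ^ (l + 1)
      / ((2 * (l : ℝ) - 3) * (2 * (l : ℝ) - 1) * (2 * (l : ℝ) + 3) * (2 * (l : ℝ) + 5)
          * (2 * (l : ℝ) + 7))
    - 2 * ((l : ℝ) - 1) ^ 2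
        * (5 * (l : ℝ) ^ 4 - 2 * (l : ℝ) ^ 3 - 41 * (l : ℝ) ^ 2 + 14 * l + 60) * r ^ (l - 1)
      / ((2 * (l : ℝ) - 5) * (2 * (l : ℝ) - 3) * (2 * (l : ℝ) + 3) * (2 * (l : ℝ) + 5))
    + ((l : ℝ) - 3) ^ 2 * ((l : ℝ) - 2) * ((l : ℝ) - 1)
        * (20 * (l : ℝ) ^ 4 - 100 * (l : ℝ) ^ 3 + 39 * (l : ℝ) ^ 2 + 239 * l - 48) * r ^ (l - 3)
      / ((2 * (l : ℝ) - 7) * (2 * (l : ℝ) - 5) * (2 * (l : ℝ) - 3) * (2 * (l : ℝ) - 1)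
          * (2 * (l : ℝ) + 1) * (2 * (l : ℝ) + 3))
    - ((l : ℝ) - 5) ^ 2 * ((l : ℝ) - 4) * ((l : ℝ) - 3) * ((l : ℝ) - 2) * ((l : ℝ) - 1)
        * r ^ (l - 5)
      / ((2 * (l : ℝ) - 7) * (2 * (l : ℝ) - 5) * (2 * (l : ℝ) - 3) * (2 * (l : ℝ) - 1))

open Topology

lemma integrableOn_mul_exp_neg_pow {m : ℕ} (hm : 0 < m) :
    IntegrableOn (fun ρ : ℝ => ρ * exp (-ρ) ^ m) (Set.Ioi 0) := by
  have h := integrableOn_rpow_mul_exp_neg_mul_rpow (p := 1) (s := 1) (b := m)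
    (by norm_num) one_pos (by exact_mod_cast hm)
  refine h.congr_fun (fun ρ _ => ?_) measurableSet_Ioi
  simp only [rpow_one, ← exp_nat_mul]
  congr 2
  ring

lemma integral_mul_exp_neg_pow {m : ℕ} (hm : 0 < m) :
    ∫ ρ in Set.Ioi (0 : ℝ), ρ * exp (-ρ) ^ m = 1 / (m : ℝ) ^ 2 := by
  have h := integral_rpow_mul_exp_neg_mul_Ioi (a := 2) (r := m) two_pos (by exact_mod_cast hm)
  rw [Gamma_two, mul_one, rpow_two, one_div_pow] at h
  rw [← h]
  refine setIntegral_congr_fun measurableSet_Ioi (fun ρ _ => ?_)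
  rw [show (2 : ℝ) - 1 = 1 by norm_num, rpow_one, ← exp_nat_mul]
  congr 2
  ring

lemma integral_mul_sq_sum_exp_neg_pow {ι : Type*} [Fintype ι] (c : ι → ℝ) (k : ι → ℕ)
    (hk : ∀ i, 0 < k i) :
    ∫ ρ in Set.Ioi (0 : ℝ), ρ * (∑ i, c i * exp (-ρ) ^ k i) ^ 2 =
      ∑ i, ∑ j, c i * c j * (1 / ((k i : ℝ) + k j) ^ 2) := by
  have hpos (i j : ι) : 0 < k i + k j := Nat.add_pos_left (hk i) _
  have hint (i j : ι) : IntegrableOn (fun ρ : ℝ => c i * c j * (ρ * exp (-ρ) ^ (k i + k j)))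
      (Set.Ioi 0) := (integrableOn_mul_exp_neg_pow (hpos i j)).const_mul _
  have hexp (ρ : ℝ) : ρ * (∑ i, c i * exp (-ρ) ^ k i) ^ 2 =
      ∑ i, ∑ j, c i * c j * (ρ * exp (-ρ) ^ (k i + k j)) := by
    rw [sq, Finset.sum_mul_sum, Finset.mul_sum]
    refine Finset.sum_congr rfl fun i _ => ?_
    rw [Finset.mul_sum]
    refine Finset.sum_congr rfl fun j _ => ?_
    ring
  simp_rw [hexp]
  rw [integral_finsetSum _ fun i _ => integrable_finsetSum _ fun j _ => hint i j]
  refine Finset.sum_congr rfl fun i _ => ?_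
  rw [integral_finsetSum _ fun j _ => hint i j]
  refine Finset.sum_congr rfl fun j _ => ?_
  rw [integral_const_mul, integral_mul_exp_neg_pow (hpos i j), Nat.cast_add]

/-- A sequence that agrees eventually with `l ↦ G (1 / l)`, for `G` continuous at `0`,
tends to `G 0`. -/
lemma tendsto_of_eventually_eq_comp_inv {f : ℕ → ℝ} {G : ℝ → ℝ} {b : ℝ}
    (hG : ContinuousAt G 0) (hb : G 0 = b) (hf : ∀ᶠ l : ℕ in atTop, f l = G ((l : ℝ)⁻¹)) :
    Tendsto f atTop (𝓝 b) := by
  rw [← hb]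
  exact (hG.tendsto.comp tendsto_inv_atTop_nhds_zero_nat).congr' (hf.mono fun _ h => h.symm)

/-- The remainder in the second-order expansion of `x ^ 4 / (2 * x + s) ^ 2` at infinity. -/
noncomputable def invSqRemainder (s x : ℝ) : ℝ :=
  x ^ 4 * (1 / (2 * x + s) ^ 2) - (x ^ 2 / 4 - s * x / 4 + 3 * s ^ 2 / 16)

lemma eventually_two_mul_add_ne_zero (s : ℝ) :
    ∀ᶠ l : ℕ in atTop, (l : ℝ) ≠ 0 ∧ 2 * (l : ℝ) + s ≠ 0 := by
  filter_upwards [tendsto_natCast_atTop_atTop.eventually_gt_atTop (|s|)] with l hl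
  have h1 := neg_abs_le s
  have h2 := abs_nonneg s
  constructor <;> apply ne_of_gt <;> linarith

lemma tendsto_invSqRemainder (s : ℝ) :
    Tendsto (fun l : ℕ => invSqRemainder s l) atTop (𝓝 0) := by
  refine tendsto_of_eventually_eq_comp_inv
    (G := fun t => -(s ^ 3 * t / 2 + 3 * s ^ 4 * t ^ 2 / 16) / (2 + s * t) ^ 2)
    (ContinuousAt.div (by fun_prop) (by fun_prop) (by norm_num)) (by norm_num) ?_
  filter_upwards [eventually_two_mul_add_ne_zero s] with l ⟨h0, h1⟩
  rw [invSqRemainder, show 2 + s * (l : ℝ)⁻¹ = (2 * l + s) / l by field_simp]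
  have h2 : (l : ℝ) * 2 + s ≠ 0 := by rwa [mul_comm]
  field_simp
  ring

lemma tendsto_sq_mul_inv_sq (s : ℝ) :
    Tendsto (fun l : ℕ => (l : ℝ) ^ 2 * (1 / (2 * (l : ℝ) + s) ^ 2)) atTop (𝓝 (1 / 4)) := by
  refine tendsto_of_eventually_eq_comp_inv (G := fun t => 1 / (2 + s * t) ^ 2)
    (ContinuousAt.div (by fun_prop) (by fun_prop) (by norm_num)) (by norm_num) ?_
  filter_upwards [eventually_two_mul_add_ne_zero s] with l ⟨h0, h1⟩
  rw [show 2 + s * (l : ℝ)⁻¹ = (2 * l + s) / l by field_simp]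
  field_simp

/-- If `c i l = a i * l ^ 2 + b i * l + o(l)` and the moments of order at most two of the weights
`a` at the nodes `n` vanish, only the linear coefficients contribute to the limit. -/
lemma tendsto_sum_mul_mul_inv_sq {ι : Type*} [Fintype ι] (n a b : ι → ℝ) (c : ι → ℕ → ℝ)
    (h0 : ∑ i, a i = 0) (h1 : ∑ i, a i * n i = 0) (h2 : ∑ i, a i * n i ^ 2 = 0)
    (hc : ∀ i, Tendsto (fun l : ℕ => c i l / l - a i * l) atTop (𝓝 (b i))) :
    Tendsto (fun l : ℕ => ∑ i, ∑ j, c i l * c j l * (1 / (2 * (l : ℝ) + (n i + n j)) ^ 2))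
      atTop (𝓝 ((∑ i, b i) ^ 2 / 4)) := by
  set e : ι → ℕ → ℝ := fun i l => c i l / l - a i * l with he
  have hinv : Tendsto (fun l : ℕ => (l : ℝ)⁻¹) atTop (𝓝 0) := tendsto_inv_atTop_nhds_zero_nat
  have hlim : Tendsto (fun l : ℕ => ∑ i, ∑ j,
      (a i * a j * invSqRemainder (n i + n j) l
        + (a i * e j l + a j * e i l) * ((l : ℝ)⁻¹ *
            (3 * (n i + n j) ^ 2 / 16 + invSqRemainder (n i + n j) l))
        + e i l * e j l * ((l : ℝ) ^ 2 * (1 / (2 * (l : ℝ) + (n i + n j)) ^ 2))))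
      atTop (𝓝 (∑ i, ∑ j, (a i * a j * 0
        + (a i * b j + a j * b i) * (0 * (3 * (n i + n j) ^ 2 / 16 + 0))
        + b i * b j * (1 / 4)))) := by
    refine tendsto_finsetSum _ fun i _ => tendsto_finsetSum _ fun j _ => ?_
    have hR := tendsto_invSqRemainder (n i + n j)
    exact ((hR.const_mul _).add ((((hc j).const_mul _).add ((hc i).const_mul _)).mul
      (hinv.mul (hR.const_add _)))).add (((hc i).mul (hc j)).mul (tendsto_sq_mul_inv_sq _))
  have hval : ∑ i, ∑ j, (a i * a j * 0
        + (a i * b j + a j * b i) * (0 * (3 * (n i + n j) ^ 2 / 16 + 0))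
        + b i * b j * (1 / 4)) = (∑ i, b i) ^ 2 / 4 := by
    rw [sq, Finset.sum_mul_sum, Finset.sum_div]
    refine Finset.sum_congr rfl fun i _ => ?_
    rw [Finset.sum_div]
    refine Finset.sum_congr rfl fun j _ => ?_
    ring
  rw [hval] at hlim
  refine hlim.congr' ?_
  filter_upwards [eventually_ne_atTop 0] with l hl
  have hl : (l : ℝ) ≠ 0 := by exact_mod_cast hl
  have hce (i : ι) : c i l = a i * l ^ 2 + e i l * l := by
    simp only [he]
    field_simp
    ring
  have hcancel : ∑ i, ∑ j, (a i * a j * ((l : ℝ) ^ 2 / 4 - (n i + n j) * l / 4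
        + 3 * (n i + n j) ^ 2 / 16)
        + (a i * e j l + a j * e i l) * ((l : ℝ) / 4 - (n i + n j) / 4)) = 0 := by
    have hrow (j : ι) : ∑ i, a i * (a j * ((l : ℝ) ^ 2 / 4 - (n i + n j) * l / 4
        + 3 * (n i + n j) ^ 2 / 16) + 2 * e j l * ((l : ℝ) / 4 - (n i + n j) / 4)) = 0 := by
      calc _ = (a j * ((l : ℝ) ^ 2 / 4 - n j * l / 4 + 3 * n j ^ 2 / 16)
              + 2 * e j l * (l / 4 - n j / 4)) * ∑ i, a i
            + (a j * (-l / 4 + 3 * n j / 8) - e j l / 2) * ∑ i, a i * n i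
            + 3 * a j / 16 * ∑ i, a i * n i ^ 2 := by
            simp only [Finset.mul_sum, ← Finset.sum_add_distrib]
            refine Finset.sum_congr rfl fun i _ => ?_
            ring
        _ = 0 := by rw [h0, h1, h2]; ring
    have hsymm : ∑ i, ∑ j, a i * e j l * ((l : ℝ) / 4 - (n i + n j) / 4) =
        ∑ i, ∑ j, a j * e i l * ((l : ℝ) / 4 - (n i + n j) / 4) := by
      rw [Finset.sum_comm]
      refine Finset.sum_congr rfl fun i _ => Finset.sum_congr rfl fun j _ => ?_
      ring
    have htotal := Finset.sum_eq_zero fun j (_ : j ∈ Finset.univ) => hrow j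
    rw [Finset.sum_comm] at htotal
    rw [← htotal, ← sub_eq_zero, ← sub_eq_zero.mpr hsymm.symm]
    simp only [← Finset.sum_sub_distrib]
    refine Finset.sum_congr rfl fun i _ => Finset.sum_congr rfl fun j _ => ?_
    ring
  rw [← sub_eq_zero, ← neg_eq_zero, ← hcancel]
  simp only [← Finset.sum_sub_distrib, ← Finset.sum_neg_distrib]
  refine Finset.sum_congr rfl fun i _ => Finset.sum_congr rfl fun j _ => ?_
  rw [hce i, hce j, invSqRemainder]
  field_simp
  ring

/-- The coefficients of the powers of `r` in `betaCoeff`. -/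
noncomputable def betaPowerCoeff (i : Fin 6) (x : ℝ) : ℝ :=
  ![(x + 2) * (x + 3) * (x + 4) * (x + 5) ^ 3
      / ((2 * x + 3) * (2 * x + 5) * (2 * x + 7) * (2 * x + 9)),
    -((x + 2) * (x + 3) ^ 3 * (5 * x ^ 2 + 21 * x - 8))
      / ((2 * x - 1) * (2 * x + 3) * (2 * x + 5) * (2 * x + 9)),
    2 * (x + 1) ^ 2
        * (10 * x ^ 5 + 65 * x ^ 4 + 83 * x ^ 3 - 134 * x ^ 2 - 186 * x + 36)
      / ((2 * x - 3) * (2 * x - 1) * (2 * x + 3) * (2 * x + 5) * (2 * x + 7)),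
    -(2 * (x - 1) ^ 2 * (5 * x ^ 4 - 2 * x ^ 3 - 41 * x ^ 2 + 14 * x + 60))
      / ((2 * x - 5) * (2 * x - 3) * (2 * x + 3) * (2 * x + 5)),
    (x - 3) ^ 2 * (x - 2) * (x - 1)
        * (20 * x ^ 4 - 100 * x ^ 3 + 39 * x ^ 2 + 239 * x - 48)
      / ((2 * x - 7) * (2 * x - 5) * (2 * x - 3) * (2 * x - 1) * (2 * x + 1) * (2 * x + 3)),
    -((x - 5) ^ 2 * (x - 4) * (x - 3) * (x - 2) * (x - 1))
      / ((2 * x - 7) * (2 * x - 5) * (2 * x - 3) * (2 * x - 1))] i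

lemma betaCoeff_eq_sum (l : ℕ) (r : ℝ) :
    betaCoeff l r = ∑ i, betaPowerCoeff i l *
      r ^ (![l + 5, l + 3, l + 1, l - 1, l - 3, l - 5] i) := by
  simp only [betaCoeff, betaPowerCoeff, Fin.sum_univ_six, Matrix.cons_val]
  ring

lemma tendsto_betaPowerCoeff_sub (i : Fin 6) :
    Tendsto (fun l : ℕ => betaPowerCoeff i l / l
        - (![1 / 16, -5 / 16, 5 / 8, -5 / 8, 5 / 16, -1 / 16] : Fin 6 → ℝ) i * l) atTop
      (𝓝 ((![3 / 4, -9 / 4, 15 / 8, 3 / 2, -5 / 2, 3 / 4] : Fin 6 → ℝ) i)) := by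
  have hlin (x : ℝ) (hx : x ≠ 0) (k : ℝ) : 2 + k * x⁻¹ = (2 * x + k) / x := by field_simp
  have hlin' (x : ℝ) (hx : x ≠ 0) (k : ℝ) : 2 - k * x⁻¹ = (2 * x - k) / x := by field_simp
  have hev : ∀ᶠ l : ℕ in atTop, (9 : ℝ) ≤ l :=
    tendsto_natCast_atTop_atTop.eventually_ge_atTop 9
  fin_cases i
  · refine tendsto_of_eventually_eq_comp_inv (G := fun t =>
        (12 + 369 / 2 * t + 1121 * t ^ 2 + 54015 / 16 * t ^ 3 + 5050 * t ^ 4 + 3000 * t ^ 5)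
        / ((2 + 3 * t) * (2 + 5 * t) * (2 + 7 * t) * (2 + 9 * t)))
      (ContinuousAt.div (by fun_prop) (by fun_prop) (by norm_num)) (by norm_num) ?_
    exact hev.mono fun l hl => by
      have h0 : (l : ℝ) ≠ 0 := ne_of_gt (by linarith)
      simp only [betaPowerCoeff, hlin _ h0, Fin.zero_eta, Matrix.cons_val]
      field_simp (disch := grind)
      ring
  · refine tendsto_of_eventually_eq_comp_inv (G := fun t =>
        (-36 - 721 / 2 * t - 1232 * t ^ 2 - 26451 / 16 * t ^ 3 - 486 * t ^ 4 + 432 * t ^ 5)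
        / ((2 - 1 * t) * (2 + 3 * t) * (2 + 5 * t) * (2 + 9 * t)))
      (ContinuousAt.div (by fun_prop) (by fun_prop) (by norm_num)) (by norm_num) ?_
    exact hev.mono fun l hl => by
      have h0 : (l : ℝ) ≠ 0 := ne_of_gt (by linarith)
      simp only [betaPowerCoeff, hlin _ h0, hlin' _ h0, Fin.mk_one, Matrix.cons_val]
      field_simp (disch := grind)
      ring
  · refine tendsto_of_eventually_eq_comp_inv (G := fun t =>
        (60 + 376 * t + 529 * t ^ 2 - 1933 / 4 * t ^ 3 - 9095 / 8 * t ^ 4 - 228 * t ^ 5 + 72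
          * t ^ 6)
        / ((2 - 3 * t) * (2 - 1 * t) * (2 + 3 * t) * (2 + 5 * t) * (2 + 7 * t)))
      (ContinuousAt.div (by fun_prop) (by fun_prop) (by norm_num)) (by norm_num) ?_
    exact hev.mono fun l hl => by
      have h0 : (l : ℝ) ≠ 0 := ne_of_gt (by linarith)
      simp only [betaPowerCoeff, hlin _ h0, hlin' _ h0, Fin.reduceFinMk, Matrix.cons_val]
      field_simp (disch := grind)
      ring
  · refine tendsto_of_eventually_eq_comp_inv (G := fun t =>
        (24 - 21 * t - 188 * t ^ 2 + 1269 / 8 * t ^ 3 + 212 * t ^ 4 - 120 * t ^ 5)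
        / ((2 - 5 * t) * (2 - 3 * t) * (2 + 3 * t) * (2 + 5 * t)))
      (ContinuousAt.div (by fun_prop) (by fun_prop) (by norm_num)) (by norm_num) ?_
    exact hev.mono fun l hl => by
      have h0 : (l : ℝ) ≠ 0 := ne_of_gt (by linarith)
      simp only [betaPowerCoeff, hlin _ h0, hlin' _ h0, Fin.reduceFinMk, Matrix.cons_val]
      field_simp (disch := grind)
      ring
  · refine tendsto_of_eventually_eq_comp_inv (G := fun t =>
        (-160 + 1394 * t - 4092 * t ^ 2 + 14473 / 4 * t ^ 3 + 8219 / 2 * t ^ 4 - 161751 / 16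
          * t ^ 5 + 6174 * t ^ 6 - 864 * t ^ 7)
        / ((2 - 7 * t) * (2 - 5 * t) * (2 - 3 * t) * (2 - 1 * t) * (2 + 1 * t) * (2 + 3 * t)))
      (ContinuousAt.div (by fun_prop) (by fun_prop) (by norm_num)) (by norm_num) ?_
    exact hev.mono fun l hl => by
      have h0 : (l : ℝ) ≠ 0 := ne_of_gt (by linarith)
      simp only [betaPowerCoeff, hlin _ h0, hlin' _ h0, Fin.reduceFinMk, Matrix.cons_val]
      field_simp (disch := grind)
      ring
  · refine tendsto_of_eventually_eq_comp_inv (G := fun t =>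
        (12 - 277 / 2 * t + 628 * t ^ 2 - 22279 / 16 * t ^ 3 + 1490 * t ^ 4 - 600 * t ^ 5)
        / ((2 - 7 * t) * (2 - 5 * t) * (2 - 3 * t) * (2 - 1 * t)))
      (ContinuousAt.div (by fun_prop) (by fun_prop) (by norm_num)) (by norm_num) ?_
    exact hev.mono fun l hl => by
      have h0 : (l : ℝ) ≠ 0 := ne_of_gt (by linarith)
      simp only [betaPowerCoeff, hlin' _ h0, Fin.reduceFinMk, Matrix.cons_val]
      field_simp (disch := grind)
      ring

theorem stmt_19 :
    Tendsto (fun l : ℕ => ∫ ρ in Set.Ioi (0:ℝ), ρ * (betaCoeff l (Real.exp (-ρ))) ^ 2)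
      atTop (nhds (1 / 256)) := by
  have hlim := tendsto_sum_mul_mul_inv_sq ![5, 3, 1, -1, -3, -5] _ _
    (fun i l => betaPowerCoeff i l)
    (by simp only [Fin.sum_univ_six, Matrix.cons_val]; norm_num)
    (by simp only [Fin.sum_univ_six, Matrix.cons_val]; norm_num)
    (by simp only [Fin.sum_univ_six, Matrix.cons_val]; norm_num) tendsto_betaPowerCoeff_sub
  have hval : (∑ i, (![3 / 4, -9 / 4, 15 / 8, 3 / 2, -5 / 2, 3 / 4] : Fin 6 → ℝ) i) ^ 2 / 4 =
      1 / 256 := by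
    simp only [Fin.sum_univ_six, Matrix.cons_val]
    norm_num
  rw [hval] at hlim
  refine hlim.congr' ?_
  filter_upwards [eventually_ge_atTop 9] with l hl
  have hcast (i : Fin 6) : ((![l + 5, l + 3, l + 1, l - 1, l - 3, l - 5] i : ℕ) : ℝ) =
      l + (![5, 3, 1, -1, -3, -5] : Fin 6 → ℝ) i := by
    fin_cases i <;> simp [Nat.cast_sub (show 1 ≤ l by lia), Nat.cast_sub (show 3 ≤ l by lia),
      Nat.cast_sub (show 5 ≤ l by lia), sub_eq_add_neg]
  simp_rw [betaCoeff_eq_sum]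
  rw [integral_mul_sq_sum_exp_neg_pow _ _ (by intro i; fin_cases i <;> simp <;> lia)]
  refine Finset.sum_congr rfl fun i _ => Finset.sum_congr rfl fun j _ => ?_
  rw [hcast, hcast]
  congr 3
  ring
end
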